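/- arXiv:2108.02227 — 2 statements merged into one kernel-verified Lean document; each statement's English description precedes it below -/
import Mathlib

section
/- Let (a_n)_{n≥1} be a strictly increasing sequence of positive integers and let ε > 0. Then for Lebesgue-almost all α ∈ [0,1] there exists N₀(α) such that for all N ≥ N₀(α) one has δ_min^α(N) ≥ 1/(C_N · log N · (log₂ N)^{1+ε}). -/
open MeasureTheory Filter

/-- Distance to the nearest integer. -/
noncomputable def nint (x : ℝ) : ℝ := |x - round x|

/-- `δ_min^α(N) = min { ‖(a_m - a_n) α‖ : 1 ≤ m, n ≤ N, m ≠ n }`. -/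
noncomputable def deltaMin (a : ℕ → ℕ) (α : ℝ) (N : ℕ) : ℝ :=
  sInf {x : ℝ | ∃ m n : ℕ, 1 ≤ m ∧ m ≤ N ∧ 1 ≤ n ∧ n ≤ N ∧ m ≠ n ∧
    x = nint (((a m : ℝ) - (a n : ℝ)) * α)}

/-- `C_N = #(A_N - A_N)` where `A_N = {a_1, …, a_N}`. -/
noncomputable def diffCard (a : ℕ → ℕ) (N : ℕ) : ℕ :=
  (((Finset.Icc 1 N) ×ˢ (Finset.Icc 1 N)).image
    (fun p : ℕ × ℕ => (a p.1 : ℤ) - (a p.2 : ℤ))).card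

/-- `log x`, read as `max {1, log x}`. -/
noncomputable def L (x : ℝ) : ℝ := max 1 (Real.log x)

/-- `log₂ x = log log x`, with the `max {1, ·}` convention. -/
noncomputable def LL (x : ℝ) : ℝ := L (L x)

/-- The points of the circle that a nonzero integer dilation brings within `δ` of `0`. -/
lemma volume_norm_zsmul_le (d : ℤ) (hd : d ≠ 0) (δ : ℝ) :
    volume {x : UnitAddCircle | ‖d • x‖ ≤ δ} ≤ ENNReal.ofReal (2 * δ) := by
  have hmp : MeasurePreserving (fun x : UnitAddCircle => d • x) volume volume :=
    Measure.measurePreserving_zsmul volume hd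
  have hset : {x : UnitAddCircle | ‖d • x‖ ≤ δ} =
      (fun x : UnitAddCircle => d • x) ⁻¹' Metric.closedBall 0 δ := by
    ext x; simp
  rw [hset, hmp.measure_preimage Metric.isClosed_closedBall.measurableSet.nullMeasurableSet,
    AddCircle.volume_closedBall]
  exact ENNReal.ofReal_le_ofReal (min_le_right _ _)

lemma nint_intCast_mul (d : ℤ) (x : ℝ) : nint (d * x) = ‖d • (x : UnitAddCircle)‖ := by
  rw [← AddCircle.coe_zsmul, UnitAddCircle.norm_eq, nint, zsmul_eq_mul]

lemma one_le_L (x : ℝ) : 1 ≤ L x := le_max_left _ _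

lemma L_le_L {x y : ℝ} (hx : 0 ≤ x) (h : x ≤ y) : L x ≤ L y := by
  rcases hx.eq_or_lt with rfl | hx
  · simp [L]
  · exact max_le_max le_rfl (Real.log_le_log hx h)

/-- The set of differences `A_N - A_N`. -/
def diffSet (a : ℕ → ℕ) (N : ℕ) : Finset ℤ :=
  ((Finset.Icc 1 N) ×ˢ (Finset.Icc 1 N)).image (fun p : ℕ × ℕ => (a p.1 : ℤ) - (a p.2 : ℤ))

lemma diffSet_mono (a : ℕ → ℕ) : Monotone (diffSet a) := fun _ _ h =>
  Finset.image_subset_image (Finset.product_subset_product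
    (Finset.Icc_subset_Icc_right h) (Finset.Icc_subset_Icc_right h))

lemma diffCard_le_sq (a : ℕ → ℕ) (N : ℕ) : diffCard a N ≤ N ^ 2 := by
  refine Finset.card_image_le.trans ?_
  simp [sq]

lemma le_diffCard {a : ℕ → ℕ} (hmono : ∀ m n, 1 ≤ m → m < n → a m < a n) (N : ℕ) :
    N ≤ diffCard a N := by
  have hinj : Set.InjOn (fun n : ℕ => (a n : ℤ) - a 1) (Finset.Icc 1 N) := by
    intro m hm n hn h
    simp only [Finset.coe_Icc, Set.mem_Icc] at hm hn
    rcases lt_trichotomy m n with hlt | heq | hlt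
    · have := hmono m n hm.1 hlt
      simp only at h; omega
    · exact heq
    · have := hmono n m hn.1 hlt
      simp only at h; omega
  calc N = ((Finset.Icc 1 N).image (fun n : ℕ => (a n : ℤ) - a 1)).card := by
        rw [Finset.card_image_of_injOn hinj]; simp
    _ ≤ diffCard a N := by
        refine Finset.card_le_card fun d hd => ?_
        simp only [Finset.mem_image, Finset.mem_Icc, Finset.mem_product, Prod.exists] at hd ⊢
        obtain ⟨n, hn, rfl⟩ := hd
        exact ⟨n, 1, ⟨hn, le_rfl, hn.1.trans hn.2⟩, rfl⟩

/-- All the difference sets of cardinality in `[2 ^ k, 2 ^ (k + 1))` lie in one of them. -/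
lemma exists_finset_diffSet_subset {a : ℕ → ℕ}
    (hmono : ∀ m n, 1 ≤ m → m < n → a m < a n) (k : ℕ) :
    ∃ D : Finset ℤ, D.card ≤ 2 ^ (k + 1) ∧
      ∀ N, Nat.log 2 (diffCard a N) = k → diffSet a N ⊆ D := by
  classical
  let P : ℕ → Prop := fun N => Nat.log 2 (diffCard a N) = k
  have hlt : ∀ N, P N → diffCard a N < 2 ^ (k + 1) := fun N hN => by
    have := Nat.lt_pow_succ_log_self (b := 2) (by norm_num) (diffCard a N)
    rwa [show Nat.log 2 (diffCard a N) = k from hN] at this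
  by_cases h : ∃ N, P N
  · obtain ⟨N, hN⟩ := h
    have hb : ∀ N, P N → N ≤ 2 ^ (k + 1) := fun N hN =>
      (le_diffCard hmono N).trans (hlt N hN).le
    exact ⟨diffSet a (Nat.findGreatest P (2 ^ (k + 1))),
      (hlt _ (Nat.findGreatest_spec (hb N hN) hN)).le,
      fun M hM => diffSet_mono a (Nat.le_findGreatest (hb M hM) hM)⟩
  · exact ⟨∅, by simp, fun N hN => (h ⟨N, hN⟩).elim⟩

lemma summable_inv_mul_L_rpow {ε : ℝ} (hε : 0 < ε) :
    Summable fun k : ℕ => 1 / (max 1 ((k : ℝ) / 4) * (L ((k : ℝ) / 4)) ^ (1 + ε)) := by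
  have hL : ∀ x, 0 < L x := fun x => one_pos.trans_le (one_le_L x)
  rw [← summable_condensed_iff_of_nonneg]
  · have hs : Summable fun j : ℕ => 4 * (11 : ℝ) ^ (1 + ε) * (1 / ((j + 1 : ℕ) : ℝ) ^ (1 + ε)) :=
      ((summable_nat_add_iff 1).2
        (Real.summable_one_div_nat_rpow.2 (by linarith : 1 < 1 + ε))).mul_left _
    refine Summable.of_nonneg_of_le (fun j => ?_) (fun j => ?_) hs
    · have := hL (((2 ^ j : ℕ) : ℝ) / 4)
      positivity
    · have hj : ((j + 1 : ℕ) : ℝ) / 11 ≤ L (((2 ^ j : ℕ) : ℝ) / 4) := by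
        rcases le_or_gt j 10 with h | h
        · refine le_trans ?_ (one_le_L _)
          rw [div_le_one (by norm_num)]
          exact_mod_cast (by omega : j + 1 ≤ 11)
        · refine le_trans ?_ (le_max_right _ _)
          have h2 := Real.log_two_gt_d9
          have h4 : Real.log 4 = 2 * Real.log 2 := by
            rw [show (4 : ℝ) = 2 ^ 2 by norm_num, Real.log_pow]; norm_num
          rw [Real.log_div (by positivity) (by norm_num), h4]
          push_cast
          rw [Real.log_pow]
          have : (11 : ℝ) ≤ j := by exact_mod_cast h
          nlinarith
      have hpow : (((j + 1 : ℕ) : ℝ) / 11) ^ (1 + ε) ≤ (L (((2 ^ j : ℕ) : ℝ) / 4)) ^ (1 + ε) :=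
        Real.rpow_le_rpow (by positivity) hj (by linarith)
      have hprod : ((2 ^ j : ℕ) : ℝ) / 4 * (((j + 1 : ℕ) : ℝ) / 11) ^ (1 + ε) ≤
          max 1 (((2 ^ j : ℕ) : ℝ) / 4) * (L (((2 ^ j : ℕ) : ℝ) / 4)) ^ (1 + ε) :=
        mul_le_mul (le_max_right _ _) hpow (by positivity) (by positivity)
      have hpos : 0 < ((2 ^ j : ℕ) : ℝ) / 4 * (((j + 1 : ℕ) : ℝ) / 11) ^ (1 + ε) := by positivity
      refine (mul_le_mul_of_nonneg_left (one_div_le_one_div_of_le hpos hprod)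
        (by positivity)).trans_eq ?_
      rw [Real.div_rpow (by positivity) (by norm_num)]
      have h1 : (0 : ℝ) < ((j + 1 : ℕ) : ℝ) ^ (1 + ε) := by positivity
      have h2 : (0 : ℝ) < (11 : ℝ) ^ (1 + ε) := by positivity
      push_cast at h1 ⊢
      field_simp
  · intro k
    have := hL ((k : ℝ) / 4)
    positivity
  · intro m n _ hmn
    have hmn' : (m : ℝ) / 4 ≤ (n : ℝ) / 4 := by gcongr
    have h1 := hL ((m : ℝ) / 4)
    have h2 := L_le_L (by positivity) hmn'
    exact one_div_le_one_div_of_le (by positivity)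
      (mul_le_mul (max_le_max le_rfl hmn') (Real.rpow_le_rpow h1.le h2 (by linarith))
        (by positivity) (by positivity))

/-- A Borel–Cantelli statement for dilations of the circle by finite families of integers. -/
lemma ae_eventually_lt_norm_zsmul (D : ℕ → Finset ℤ) (hD : ∀ k, (D k).card ≤ 2 ^ (k + 1))
    {g : ℕ → ℝ} (hg : ∀ k, 0 ≤ g k) (hs : Summable g) :
    ∀ᵐ x : UnitAddCircle, ∀ᶠ k in atTop, ∀ d ∈ D k, d ≠ 0 → g k / 2 ^ k < ‖d • x‖ := by
  let B : ℕ → Set UnitAddCircle := fun k =>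
    ⋃ d ∈ (D k).filter (· ≠ 0), {x | ‖d • x‖ ≤ g k / 2 ^ k}
  have hB : ∀ k, volume (B k) ≤ ENNReal.ofReal (4 * g k) := fun k => by
    calc volume (B k) ≤ ∑ d ∈ (D k).filter (· ≠ 0), volume {x : UnitAddCircle |
            ‖d • x‖ ≤ g k / 2 ^ k} := measure_biUnion_finset_le _ _
      _ ≤ ∑ d ∈ (D k).filter (· ≠ 0), ENNReal.ofReal (2 * (g k / 2 ^ k)) :=
          Finset.sum_le_sum fun d hd => volume_norm_zsmul_le d (Finset.mem_filter.1 hd).2 _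
      _ = ENNReal.ofReal (((D k).filter (· ≠ 0)).card * (2 * (g k / 2 ^ k))) := by
          rw [Finset.sum_const, nsmul_eq_mul, ENNReal.ofReal_mul (Nat.cast_nonneg _),
            ENNReal.ofReal_natCast]
      _ ≤ ENNReal.ofReal (4 * g k) := by
          refine ENNReal.ofReal_le_ofReal ?_
          have hc : (((D k).filter (· ≠ 0)).card : ℝ) ≤ 2 ^ (k + 1) := by
            exact_mod_cast (Finset.card_filter_le _ _).trans (hD k)
          have := hg k
          refine (mul_le_mul_of_nonneg_right hc (by positivity)).trans_eq ?_
          field_simp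
          ring
  have hsum : ∑' k, volume (B k) ≠ ⊤ :=
    ne_top_of_le_ne_top (hs.mul_left 4).tsum_ofReal_ne_top (ENNReal.tsum_le_tsum hB)
  filter_upwards [ae_eventually_notMem hsum] with x hx
  filter_upwards [hx] with k hk d hd hd0
  by_contra! h
  exact hk (Set.mem_biUnion (Finset.mem_filter.2 ⟨hd, hd0⟩) h)

lemma ae_real_of_ae_unitAddCircle {p : UnitAddCircle → Prop} (h : ∀ᵐ x, p x) :
    ∀ᵐ α : ℝ, α ∈ Set.Icc (0 : ℝ) 1 → p α := by
  have h1 : ∀ᵐ α : ℝ ∂(volume.restrict (Set.Ioc (0 : ℝ) (0 + 1))), p α :=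
    (AddCircle.measurePreserving_mk 1 0).quasiMeasurePreserving.ae h
  rwa [zero_add, restrict_Ioc_eq_restrict_Icc, ae_restrict_iff' measurableSet_Icc] at h1

/-- The threshold at `N` is at most the threshold of the dyadic block containing `diffCard a N`. -/
lemma threshold_le {a : ℕ → ℕ} (hmono : ∀ m n, 1 ≤ m → m < n → a m < a n) {ε : ℝ}
    (hε : 0 < ε) {N k : ℕ} (hN : 1 ≤ N) (hk : Nat.log 2 (diffCard a N) = k) :
    1 / ((diffCard a N : ℝ) * L N * (LL N) ^ (1 + ε)) ≤
      1 / (max 1 ((k : ℝ) / 4) * (L ((k : ℝ) / 4)) ^ (1 + ε)) / 2 ^ k := by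
  have hC : 2 ^ k ≤ diffCard a N := by
    rw [← hk]
    exact Nat.pow_log_le_self 2 (by have := le_diffCard hmono N; omega)
  have hlog : (k : ℝ) / 4 ≤ Real.log N := by
    have h1 : ((2 : ℝ) ^ k) ≤ (N : ℝ) ^ 2 := by exact_mod_cast hC.trans (diffCard_le_sq a N)
    have h2 := Real.log_le_log (by positivity) h1
    rw [Real.log_pow, Real.log_pow] at h2
    have h3 := Real.log_two_gt_d9
    have h4 : (0 : ℝ) ≤ k := Nat.cast_nonneg k
    push_cast at h2
    nlinarith
  have hLN : max 1 ((k : ℝ) / 4) ≤ L N := max_le_max le_rfl hlog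
  have hLLN : L ((k : ℝ) / 4) ≤ LL N :=
    L_le_L (by positivity) ((le_max_right _ _).trans hLN)
  have hL0 : 0 < L ((k : ℝ) / 4) := one_pos.trans_le (one_le_L _)
  have hC' : (2 : ℝ) ^ k ≤ diffCard a N := by exact_mod_cast hC
  rw [div_div]
  refine one_div_le_one_div_of_le (by positivity) ?_
  calc max 1 ((k : ℝ) / 4) * (L ((k : ℝ) / 4)) ^ (1 + ε) * 2 ^ k
      = 2 ^ k * max 1 ((k : ℝ) / 4) * (L ((k : ℝ) / 4)) ^ (1 + ε) := by ring
    _ ≤ _ := by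
        have h1 := one_le_L (N : ℝ)
        gcongr

theorem stmt2 (a : ℕ → ℕ)
    (hpos : ∀ n, 1 ≤ n → 0 < a n)
    (hmono : ∀ m n, 1 ≤ m → m < n → a m < a n)
    (ε : ℝ) (hε : 0 < ε) :
    ∀ᵐ α ∂(volume : Measure ℝ), α ∈ Set.Icc (0 : ℝ) 1 →
      ∃ N₀ : ℕ, ∀ N ≥ N₀,
        deltaMin a α N ≥ 1 / ((diffCard a N : ℝ) * L N * (LL N) ^ (1 + ε)) := by
  choose D hDcard hD using exists_finset_diffSet_subset hmono
  have hg : ∀ k : ℕ, 0 ≤ 1 / (max 1 ((k : ℝ) / 4) * (L ((k : ℝ) / 4)) ^ (1 + ε)) := fun k => by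
    have := one_pos.trans_le (one_le_L ((k : ℝ) / 4))
    positivity
  filter_upwards [ae_real_of_ae_unitAddCircle
    (ae_eventually_lt_norm_zsmul D hDcard hg (summable_inv_mul_L_rpow hε))] with α hα hmem
  obtain ⟨K, hK⟩ := eventually_atTop.1 (hα hmem)
  refine ⟨2 ^ K + 2, fun N hN => ?_⟩
  have hN2 : 2 ≤ N := (Nat.le_add_left _ _).trans hN
  have hKle : K ≤ Nat.log 2 (diffCard a N) :=
    Nat.le_log_of_pow_le (by norm_num) 
      ((Nat.le_add_right _ _).trans (hN.trans (le_diffCard hmono N)))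
  refine le_csInf ⟨_, 1, 2, le_rfl, by omega, by omega, by omega, by omega, rfl⟩ ?_
  rintro x ⟨m, n, hm1, hmN, hn1, hnN, hmn, rfl⟩
  have hd0 : (a m : ℤ) - a n ≠ 0 := by
    rcases lt_or_gt_of_ne hmn with h | h
    · have := hmono m n hm1 h; omega
    · have := hmono n m hn1 h; omega
  have hdmem : (a m : ℤ) - a n ∈ diffSet a N :=
    Finset.mem_image.2 ⟨(m, n), by simp [*], rfl⟩
  have hnint := nint_intCast_mul ((a m : ℤ) - a n) α
  push_cast at hnint
  rw [hnint]
  exact (threshold_le hmono hε (by omega) rfl).trans (hK _ hKle _ (hD _ N rfl hdmem) hd0).le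
end

section
/- Let (a_n)_{n≥1} be a strictly increasing sequence of positive integers and let (η(N))_{N≥1} be a sequence of non-negative reals. Let 𝒜 = {α ∈ [0,1] : δ_min^α(N) ≤ η(N) for infinitely many N}. If the series Σ_{k=1}^∞ φ(k) · sup_{b≥1} { (sup_{ℓ ≥ 𝒩(bk)} η(ℓ)) / (bk) } converges, then the Lebesgue measure of 𝒜 equals 0. -/
open MeasureTheory Filter
open scoped ENNReal NNReal

/-- `k ∈ (A_M − A_M)⁺`, i.e. `k = a_m − a_n > 0` for some `1 ≤ m, n ≤ M`
(for a positive integer `k`, encoded as `a n + k = a m`). -/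
def inDiffPos (a : ℕ → ℕ) (k M : ℕ) : Prop :=
  ∃ m n : ℕ, 1 ≤ m ∧ m ≤ M ∧ 1 ≤ n ∧ n ≤ M ∧ a n + k = a m

/-- `𝒩(k) = min {M ≥ 1 : k ∈ (A_M − A_M)⁺}`, with value `⊤ = ∞` if no such `M` exists. -/
noncomputable def calN (a : ℕ → ℕ) (k : ℕ) : ℕ∞ :=
  ⨅ (M : ℕ) (_ : 1 ≤ M ∧ inDiffPos a k M), (M : ℕ∞)

/-- The `k`-th term `φ(k) · sup_{b ≥ 1} { (sup_{ℓ ≥ 𝒩(bk)} η(ℓ)) / (bk) }` of the series,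
computed in `ℝ≥0∞` (empty suprema are `0`). -/
noncomputable def seriesTerm (a : ℕ → ℕ) (η : ℕ → ℝ) (k : ℕ) : ℝ≥0∞ :=
  (Nat.totient k : ℝ≥0∞) *
    ⨆ (b : ℕ) (_ : 1 ≤ b),
      (⨆ (ℓ : ℕ) (_ : calN a (b * k) ≤ (ℓ : ℕ∞)), ENNReal.ofReal (η ℓ)) /
        ((b * k : ℕ) : ℝ≥0∞)

/-- The radius `sup_{b ≥ 1} (sup_{ℓ ≥ 𝒩(bk)} η(ℓ)) / (bk)` attached to the denominator `k`. -/
noncomputable def denomRadius (a : ℕ → ℕ) (η : ℕ → ℝ) (k : ℕ) : ℝ≥0∞ :=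
  ⨆ (b : ℕ) (_ : 1 ≤ b),
    (⨆ (ℓ : ℕ) (_ : calN a (b * k) ≤ (ℓ : ℕ∞)), ENNReal.ofReal (η ℓ)) /
      ((b * k : ℕ) : ℝ≥0∞)

theorem seriesTerm_eq (a : ℕ → ℕ) (η : ℕ → ℝ) (k : ℕ) :
    seriesTerm a η k = (Nat.totient k : ℝ≥0∞) * denomRadius a η k := rfl

theorem tsum_seriesTerm_ne_top {a : ℕ → ℕ} {η : ℕ → ℝ}
    (h : (∑' k : ℕ, seriesTerm a η (k + 1)) ≠ ⊤) : (∑' k : ℕ, seriesTerm a η k) ≠ ⊤ := by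
  rw [tsum_eq_zero_add' ENNReal.summable]
  simpa [seriesTerm_eq a η 0] using h

theorem ofReal_div_le_denomRadius (a : ℕ → ℕ) (η : ℕ → ℝ) {b k ℓ : ℕ} (hb : 1 ≤ b)
    (hℓ : calN a (b * k) ≤ (ℓ : ℕ∞)) :
    ENNReal.ofReal (η ℓ) / ((b * k : ℕ) : ℝ≥0∞) ≤ denomRadius a η k := by
  refine le_iSup₂_of_le b hb (ENNReal.div_le_div_right ?_ _)
  exact le_iSup₂ (f := fun (ℓ : ℕ) (_ : calN a (b * k) ≤ (ℓ : ℕ∞)) => ENNReal.ofReal (η ℓ)) ℓ hℓ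

theorem calN_le {a : ℕ → ℕ} {k M : ℕ} (hM : 1 ≤ M) (h : inDiffPos a k M) :
    calN a k ≤ (M : ℕ∞) :=
  iInf₂_le M ⟨hM, h⟩

/-- The union of the intervals of radius `denomRadius` about the reduced fractions in `[0, 1]`
with denominator `k`. -/
noncomputable def reducedNbhd (a : ℕ → ℕ) (η : ℕ → ℝ) (k : ℕ) : Set ℝ :=
  ⋃ p ∈ (Finset.range (k + 1)).filter (fun p => k.Coprime p),
    Metric.closedEBall ((p : ℝ) / k) (denomRadius a η k)

theorem card_filter_coprime_range_succ_le (k : ℕ) :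
    ((Finset.range (k + 1)).filter (fun p => k.Coprime p)).card ≤ 2 * k.totient := by
  rcases Nat.eq_zero_or_pos k with rfl | hk
  · decide
  · have h1 : 0 < k.totient := Nat.totient_pos.2 hk
    have h2 : ((Finset.range (k + 1)).filter (fun p => k.Coprime p)).card ≤ k.totient + 1 := by
      rw [Finset.range_add_one, Finset.filter_insert, Nat.totient]
      split_ifs
      · exact Finset.card_insert_le _ _
      · omega
    omega

theorem volume_reducedNbhd_le (a : ℕ → ℕ) (η : ℕ → ℝ) (k : ℕ) :
    volume (reducedNbhd a η k) ≤ 4 * seriesTerm a η k := by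
  refine (measure_biUnion_finset_le _ _).trans ?_
  simp only [Real.volume_closedEBall, Finset.sum_const, nsmul_eq_mul]
  calc _ ≤ ((2 * k.totient : ℕ) : ℝ≥0∞) * (2 * denomRadius a η k) := by
        gcongr
        exact card_filter_coprime_range_succ_le k
    _ = _ := by
        rw [seriesTerm_eq]
        push_cast
        ring

theorem ae_eventually_notMem_reducedNbhd {a : ℕ → ℕ} {η : ℕ → ℝ}
    (h : (∑' k : ℕ, seriesTerm a η k) ≠ ⊤) :
    ∀ᵐ α : ℝ, ∀ᶠ k in atTop, α ∉ reducedNbhd a η k := by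
  refine ae_eventually_notMem (ne_top_of_le_ne_top ?_
    (ENNReal.tsum_le_tsum (volume_reducedNbhd_le a η)))
  rw [ENNReal.tsum_mul_left]
  exact ENNReal.mul_ne_top (by simp) h

/-- Convergence of the series forces `η` to tend to zero. -/
theorem eventually_lt_of_tsum_seriesTerm_ne_top {a : ℕ → ℕ}
    (hmono : ∀ m n, 1 ≤ m → m < n → a m < a n) {η : ℕ → ℝ}
    (h : (∑' k : ℕ, seriesTerm a η k) ≠ ⊤) {ε : ℝ} (hε : 0 < ε) :
    ∀ᶠ N in atTop, η N < ε := by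
  by_contra hcon
  have hfreq : ∃ᶠ N in atTop, ε ≤ η N := by
    simpa [Filter.Frequently] using hcon
  let d : ℕ → ℕ := fun m => a (m + 2) - a 1
  have had : ∀ m, a 1 + d m = a (m + 2) := fun m => by
    have := hmono 1 (m + 2) le_rfl (by omega)
    grind
  have hd : ∀ m, m < d m := by
    intro m
    induction m with
    | zero => have := hmono 1 2 le_rfl (by omega); have := had 0; simp at this; omega
    | succ m ih =>
      have := hmono (m + 2) (m + 1 + 2) (by omega) (by omega)
      have := had m
      have := had (m + 1)
      omega
  have hd0 : ∀ m, d m ≠ 0 := fun m => (Nat.zero_le m |>.trans_lt (hd m)).ne'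
  let u : ℕ → ℕ → ℝ := fun m k => if k ∣ d m then (k.totient : ℝ) * (ε / d m) else 0
  have hsum : ∀ m, ∑' k, u m k = ε := by
    intro m
    rw [tsum_eq_sum (s := (d m).divisors)]
    · have : ∀ k ∈ (d m).divisors, u m k = (k.totient : ℝ) * (ε / d m) := fun k hk =>
        if_pos (Nat.dvd_of_mem_divisors hk)
      rw [Finset.sum_congr rfl this, ← Finset.sum_mul, ← Nat.cast_sum, Nat.sum_totient]
      have : (d m : ℝ) ≠ 0 := by exact_mod_cast hd0 m
      field_simp
    · intro k hk
      refine if_neg fun hdvd => hk (Nat.mem_divisors.2 ⟨hdvd, hd0 m⟩)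
  have hterm : ∀ k, seriesTerm a η k ≠ ⊤ := fun k => ENNReal.ne_top_of_tsum_ne_top h k
  have hbound : ∀ m k, ‖u m k‖ ≤ (seriesTerm a η k).toReal := by
    intro m k
    by_cases hk : k ∣ d m
    · have hdm : (0 : ℝ) < d m := by exact_mod_cast Nat.pos_of_ne_zero (hd0 m)
      have hu : u m k = (k.totient : ℝ) * (ε / d m) := if_pos hk
      rw [hu, Real.norm_of_nonneg (by positivity),
        ← ENNReal.ofReal_le_iff_le_toReal (hterm k), ENNReal.ofReal_mul (by positivity),
        ENNReal.ofReal_natCast, ENNReal.ofReal_div_of_pos hdm, ENNReal.ofReal_natCast,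
        seriesTerm_eq]
      gcongr
      obtain ⟨b, hb⟩ := hk
      rw [mul_comm] at hb
      obtain ⟨ℓ, hℓ, hεℓ⟩ := frequently_atTop.1 hfreq (m + 2)
      have hcal : calN a (b * k) ≤ (ℓ : ℕ∞) := by
        rw [← hb]
        exact calN_le (by omega) ⟨m + 2, 1, by omega, hℓ, le_rfl, by omega, had m⟩
      have hb1 : 1 ≤ b := by
        rcases Nat.eq_zero_or_pos b with rfl | hb'
        · exact absurd (by simpa using hb) (hd0 m)
        · exact hb'
      rw [hb]
      exact (ENNReal.div_le_div_right (ENNReal.ofReal_le_ofReal hεℓ) _).trans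
        (ofReal_div_le_denomRadius a η hb1 hcal)
    · simp [u, hk]
  have hdlim : Tendsto (fun m => (d m : ℝ)) atTop atTop :=
    tendsto_natCast_atTop_atTop.comp (tendsto_atTop_mono (fun m => (hd m).le) tendsto_id)
  have hlim : ∀ k, Tendsto (fun m => u m k) atTop (nhds 0) := by
    intro k
    have h0 : Tendsto (fun m => (k.totient : ℝ) * (ε / d m)) atTop (nhds 0) := by
      simpa using (hdlim.const_div_atTop ε).const_mul (k.totient : ℝ)
    refine squeeze_zero (fun m => ?_) (fun m => ?_) h0 <;> dsimp only [u] <;> split_ifs <;>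
      first | positivity | exact le_rfl
  have htend := tendsto_tsum_of_dominated_convergence (ENNReal.summable_toReal h) hlim
    (Eventually.of_forall hbound)
  simp only [hsum, tsum_zero] at htend
  exact hε.ne' (tendsto_nhds_unique tendsto_const_nhds htend)

theorem exists_nint_le_of_deltaMin_le {a : ℕ → ℕ}
    (hmono : ∀ m n, 1 ≤ m → m < n → a m < a n) {α x : ℝ} {N : ℕ} (hN : 2 ≤ N)
    (h : deltaMin a α N ≤ x) :
    ∃ d : ℕ, 0 < d ∧ inDiffPos a d N ∧ nint (d * α) ≤ x := by
  let S : Set ℝ := {x : ℝ | ∃ m n : ℕ, 1 ≤ m ∧ m ≤ N ∧ 1 ≤ n ∧ n ≤ N ∧ m ≠ n ∧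
    x = nint (((a m : ℝ) - (a n : ℝ)) * α)}
  have hne : S.Nonempty := ⟨_, 1, 2, le_rfl, by omega, by omega, hN, by omega, rfl⟩
  have hfin : S.Finite := by
    refine (((Set.finite_Icc 1 N).prod (Set.finite_Icc 1 N)).image
      (fun q : ℕ × ℕ => nint (((a q.1 : ℝ) - (a q.2 : ℝ)) * α))).subset ?_
    rintro y ⟨m, n, hm, hm', hn, hn', -, rfl⟩
    exact ⟨(m, n), ⟨⟨hm, hm'⟩, ⟨hn, hn'⟩⟩, rfl⟩
  obtain ⟨m, n, hm, hm', hn, hn', hmn, hmin⟩ := hne.csInf_mem hfin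
  have hle : nint (((a m : ℝ) - (a n : ℝ)) * α) ≤ x := hmin ▸ h
  have habs : ∀ y : ℝ, nint y = |y - round y| := fun _ => rfl
  have hneg : ∀ y : ℝ, nint (-y) ≤ nint y := by
    intro y
    calc nint (-y) ≤ |-y - ((-round y : ℤ) : ℝ)| := round_le _ _
      _ = nint y := by
        rw [habs, ← abs_neg (y - round y)]
        congr 1
        push_cast
        ring
  rcases lt_or_gt_of_ne hmn with hlt | hlt
  · have hak := hmono m n hm hlt
    refine ⟨a n - a m, by omega, ⟨n, m, hn, hn', hm, hm', by omega⟩, le_trans ?_ hle⟩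
    rw [Nat.cast_sub hak.le, ← neg_sub, neg_mul]
    exact hneg _
  · have hak := hmono n m hn hlt
    refine ⟨a m - a n, by omega, ⟨m, n, hm, hm', hn, hn', by omega⟩, ?_⟩
    rwa [Nat.cast_sub hak.le]

/-- A good approximation with difference `d` reduces to one in lowest terms. -/
theorem exists_mem_reducedNbhd {a : ℕ → ℕ} {η : ℕ → ℝ} {α : ℝ}
    (hα : α ∈ Set.Icc (0 : ℝ) 1) {N d : ℕ} (hN : 1 ≤ N) (hd : 0 < d)
    (hdiff : inDiffPos a d N) (h : nint (d * α) ≤ η N) :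
    ∃ k p : ℕ, 0 < k ∧ α ∈ reducedNbhd a η k ∧ |α - p / k| ≤ η N := by
  have hdR : (0 : ℝ) < d := by exact_mod_cast hd
  have hr0 : 0 ≤ round (d * α) := by
    rw [round_eq]
    exact Int.floor_nonneg.2 (by have := mul_nonneg hdR.le hα.1; linarith)
  have hrd : round (d * α) ≤ d := by
    rw [round_eq, ← Int.lt_add_one_iff, Int.floor_lt]
    have := mul_le_mul_of_nonneg_left hα.2 hdR.le
    push_cast
    linarith
  obtain ⟨p, hp⟩ := Int.eq_ofNat_of_zero_le hr0
  have hpd : p ≤ d := by omega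
  have hnear : |α - p / d| ≤ η N / d := by
    have : d * α - ((p : ℤ) : ℝ) = (α - p / d) * d := by
      field_simp
      simp
    rw [nint, hp, this, abs_mul, abs_of_pos hdR] at h
    rwa [le_div_iff₀ hdR]
  have hη : 0 ≤ η N := (abs_nonneg _).trans h
  set g := d.gcd p with hg
  have hgpos : 0 < g := Nat.gcd_pos_of_pos_left _ hd
  obtain ⟨k, hk⟩ : g ∣ d := Nat.gcd_dvd_left d p
  obtain ⟨q, hq⟩ : g ∣ p := Nat.gcd_dvd_right d p
  have hkpos : 0 < k := Nat.pos_of_ne_zero (by rintro rfl; simp at hk; omega)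
  have hcop : k.Coprime q := by
    have := Nat.coprime_div_gcd_div_gcd (m := d) (n := p) hgpos
    rwa [← hg, Nat.div_eq_of_eq_mul_right hgpos hk, Nat.div_eq_of_eq_mul_right hgpos hq] at this
  have hqk : q ≤ k := by
    rw [hk, hq] at hpd
    exact Nat.le_of_mul_le_mul_left hpd hgpos
  have hfrac : (p : ℝ) / d = q / k := by
    have : (g : ℝ) ≠ 0 := by exact_mod_cast hgpos.ne'
    rw [hk, hq]
    push_cast
    exact mul_div_mul_left _ _ this
  rw [hfrac] at hnear
  refine ⟨k, q, hkpos, ?_, hnear.trans (div_le_self hη (by exact_mod_cast hd))⟩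
  refine Set.mem_biUnion (x := q) (by simpa using ⟨hqk, hcop⟩) ?_
  rw [Metric.mem_closedEBall, edist_dist, Real.dist_eq]
  have hcal : calN a (g * k) ≤ (N : ℕ∞) := hk ▸ calN_le hN hdiff
  refine le_trans ?_ (ofReal_div_le_denomRadius a η hgpos hcal)
  rw [← hk, ← ENNReal.ofReal_natCast, ← ENNReal.ofReal_div_of_pos hdR]
  exact ENNReal.ofReal_le_ofReal hnear

theorem exists_pos_forall_le_abs_sub_div {α : ℝ} (hα : Irrational α) {k : ℕ} (hk : 0 < k) :
    ∃ ε : ℝ, 0 < ε ∧ ∀ p : ℕ, ε ≤ |α - p / k| := by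
  have hkR : (0 : ℝ) < k := by exact_mod_cast hk
  refine ⟨|k * α - round (k * α)| / k, ?_, fun p => ?_⟩
  · exact div_pos (abs_pos.2 (sub_ne_zero.2 ((hα.natCast_mul hk.ne').ne_int _))) hkR
  · have : k * α - ((p : ℤ) : ℝ) = (α - p / k) * k := by
      field_simp
      simp
    rw [div_le_iff₀ hkR, ← abs_of_pos hkR, ← abs_mul, abs_of_pos hkR, ← this]
    exact round_le _ _


theorem stmt4 (a : ℕ → ℕ)
    (hpos : ∀ n, 1 ≤ n → 0 < a n)
    (hmono : ∀ m n, 1 ≤ m → m < n → a m < a n)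
    (η : ℕ → ℝ) (hη : ∀ N, 0 ≤ η N)
    (hconv : (∑' k : ℕ, seriesTerm a η (k + 1)) ≠ ⊤) :
    volume {α : ℝ | α ∈ Set.Icc (0 : ℝ) 1 ∧
      (∃ᶠ N in atTop, deltaMin a α N ≤ η N)} = 0 := by
  have hsum := tsum_seriesTerm_ne_top hconv
  have hirr : ∀ᵐ α : ℝ, Irrational α := by
    have := (Set.countable_range ((↑) : ℚ → ℝ)).ae_notMem volume
    simpa [Irrational] using this
  rw [measure_eq_zero_iff_ae_notMem]
  filter_upwards [hirr, ae_eventually_notMem_reducedNbhd hsum] with α hα hev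
  rintro ⟨hα01, hfreq⟩
  obtain ⟨K, hK⟩ := eventually_atTop.1 hev
  have hlarge : ∀ᶠ N in atTop, ∀ k ∈ Finset.range K, 0 < k → ∀ p : ℕ, η N < |α - p / k| := by
    refine (eventually_all_finset _).2 fun k _ => ?_
    rcases Nat.eq_zero_or_pos k with rfl | hk
    · simp
    · obtain ⟨ε, hε, hle⟩ := exists_pos_forall_le_abs_sub_div hα hk
      filter_upwards [eventually_lt_of_tsum_seriesTerm_ne_top hmono hsum hε] with N hN _ p
      exact hN.trans_le (hle p)
  obtain ⟨N, hN, hlargeN, hN2⟩ := (hfreq.and_eventually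
    (hlarge.and (eventually_ge_atTop 2))).exists
  obtain ⟨d, hd, hdiff, hnint⟩ := exists_nint_le_of_deltaMin_le hmono hN2 hN
  obtain ⟨k, p, hk, hmem, hclose⟩ :=
    exists_mem_reducedNbhd hα01 (by omega) hd hdiff hnint
  have hkK : k < K := by
    by_contra hcon
    exact hK k (not_lt.1 hcon) hmem
  exact absurd hclose (not_le.2 (hlargeN k (Finset.mem_range.2 hkK) hk p))
end
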